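/- Let R₁(X) ∈ ℂ(X) be a non-constant rational function written in lowest terms and suppose a non-constant D(X,Y) ∈ ℂ[X,Y] divides the Bézoutian B*_{R₁}(X,Y). Then there exists R(X) ∈ ℂ(X) with deg(R) ≥ 2 and R = P/Q with deg P > deg Q, such that for any R₂(X) ∈ ℂ(X), D(X,Y) divides B*_{R₂}(X,Y) if and only if R₂ ∈ ℂ(R(X)). -/

import Mathlib

namespace BezAux

open MvPolynomial

/-- The Bezoutian numerator attached to a pair of polynomials. -/
noncomputable def bez (p q : Polynomial ℂ) : MvPolynomial (Fin 2) ℂ :=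
  Polynomial.aeval (X 0 : MvPolynomial (Fin 2) ℂ) q * Polynomial.aeval (X 1 : MvPolynomial (Fin 2) ℂ) p
        - Polynomial.aeval (X 0 : MvPolynomial (Fin 2) ℂ) p * Polynomial.aeval (X 1 : MvPolynomial (Fin 2) ℂ) q

/-- The field of rational functions whose Bezoutian is divisible by `F`. -/
noncomputable def fld (F : MvPolynomial (Fin 2) ℂ) : IntermediateField ℂ (RatFunc ℂ) where
  carrier := {r | ∃ p q : Polynomial ℂ, q ≠ 0 ∧
    r = algebraMap (Polynomial ℂ) (RatFunc ℂ) p / algebraMap (Polynomial ℂ) (RatFunc ℂ) q ∧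
    F ∣ bez p q}
  mul_mem' := by
    rintro _ _ ⟨p, q, hq, rfl, h⟩ ⟨p', q', hq', rfl, h'⟩
    refine ⟨p * p', q * q', mul_ne_zero hq hq', ?_, ?_⟩
    · rw [map_mul, map_mul, div_mul_div_comm]
    · have : bez (p * p') (q * q') =
          Polynomial.aeval (X 0 : MvPolynomial (Fin 2) ℂ) q' *
            Polynomial.aeval (X 1 : MvPolynomial (Fin 2) ℂ) p' * bez p q
          + Polynomial.aeval (X 0 : MvPolynomial (Fin 2) ℂ) p *
            Polynomial.aeval (X 1 : MvPolynomial (Fin 2) ℂ) q * bez p' q' := by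
        simp only [bez, map_mul]; ring
      rw [this]
      exact dvd_add (h.mul_left _) (h'.mul_left _)
  add_mem' := by
    rintro _ _ ⟨p, q, hq, rfl, h⟩ ⟨p', q', hq', rfl, h'⟩
    refine ⟨p * q' + q * p', q * q', mul_ne_zero hq hq', ?_, ?_⟩
    · rw [map_add, map_mul, map_mul, map_mul, div_add_div]
      · exact RatFunc.algebraMap_ne_zero hq
      · exact RatFunc.algebraMap_ne_zero hq'
    · have : bez (p * q' + q * p') (q * q') =
          Polynomial.aeval (X 0 : MvPolynomial (Fin 2) ℂ) q' *
            Polynomial.aeval (X 1 : MvPolynomial (Fin 2) ℂ) q' * bez p q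
          + Polynomial.aeval (X 0 : MvPolynomial (Fin 2) ℂ) q *
            Polynomial.aeval (X 1 : MvPolynomial (Fin 2) ℂ) q * bez p' q' := by
        simp only [bez, map_mul, map_add]; ring
      rw [this]
      exact dvd_add (h.mul_left _) (h'.mul_left _)
  algebraMap_mem' c := by
    refine ⟨Polynomial.C c, 1, one_ne_zero, ?_, ?_⟩
    · simp
    · simp [bez]
  inv_mem' := by
    rintro _ ⟨p, q, hq, rfl, h⟩
    by_cases hp : p = 0
    · subst hp
      exact ⟨0, 1, one_ne_zero, by simp, by simp [bez]⟩
    · refine ⟨q, p, hp, by rw [inv_div], ?_⟩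
      have : bez q p = - bez p q := by simp only [bez]; ring
      rw [this]
      exact h.neg_right

lemma prime_X_sub_C (i : Fin 2) (a : ℂ) : Prime (X i - C a : MvPolynomial (Fin 2) ℂ) := by
  have h : Irreducible (X i - C a : MvPolynomial (Fin 2) ℂ) := by
    apply irreducible_of_totalDegree_eq_one
    · apply le_antisymm
      · refine (totalDegree_sub _ _).trans (max_le ?_ ?_) <;> simp
      · have hm : Finsupp.single i 1 ∈ (X i - C a : MvPolynomial (Fin 2) ℂ).support := by
          simp [mem_support_iff, coeff_X, coeff_C, eq_comm]
        simpa using le_totalDegree hm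
    · intro x hx
      have := hx (Finsupp.single i 1)
      simp [coeff_X, coeff_C, eq_comm] at this
      exact IsUnit.mk0 x this
  exact h.prime

lemma not_prop {P Q : Polynomial ℂ} (hc : IsCoprime P Q) (hQ : Q ≠ 0)
    (hR : 1 ≤ max P.natDegree Q.natDegree) (a : ℂ)
    (h : Polynomial.C (Q.eval a) * P = Polynomial.C (P.eval a) * Q) : False := by
  have key : ∀ (A B : Polynomial ℂ), IsCoprime A B → B.eval a ≠ 0 →
      Polynomial.C (B.eval a) * A = Polynomial.C (A.eval a) * B →
      A.natDegree = 0 ∧ B.natDegree = 0 := by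
    intro A B hAB hB hE
    have hA : B ∣ A := by
      refine ⟨Polynomial.C (A.eval a / B.eval a), ?_⟩
      have h2 : Polynomial.C (B.eval a)⁻¹ * (Polynomial.C (B.eval a) * A) = Polynomial.C (B.eval a)⁻¹ * (Polynomial.C (A.eval a) * B) := by rw [hE]
      rw [← mul_assoc, ← Polynomial.C_mul, inv_mul_cancel₀ hB] at h2
      rw [div_eq_mul_inv, Polynomial.C_mul]
      simp only [map_one, one_mul] at h2
      linear_combination h2
    have hu : IsUnit B := hAB.isUnit_of_dvd' hA dvd_rfl
    have hB0 := Polynomial.natDegree_eq_zero_of_isUnit hu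
    refine ⟨?_, hB0⟩
    have := congrArg Polynomial.natDegree hE
    rw [Polynomial.natDegree_C_mul hB] at this
    have h3 := Polynomial.natDegree_C_mul_le (A.eval a) B
    omega
  by_cases hb : Q.eval a = 0
  · have ha : P.eval a ≠ 0 := by
      intro ha
      obtain ⟨u, v, huv⟩ := hc
      have := congrArg (Polynomial.eval a) huv
      simp [ha, hb] at this
    have := key Q P hc.symm ha h.symm
    omega
  · have := key P Q hc hb h
    omega

lemma not_dvd_bez {P Q : Polynomial ℂ} (hc : IsCoprime P Q) (hQ : Q ≠ 0)
    (hR : 1 ≤ max P.natDegree Q.natDegree) (i : Fin 2) (a : ℂ) :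
    ¬ (X i - C a : MvPolynomial (Fin 2) ℂ) ∣ bez P Q := by
  intro h
  let v : Fin 2 → Polynomial ℂ := fun j => if j = i then Polynomial.C a else Polynomial.X
  have hv : aeval v (bez P Q) = 0 := by
    obtain ⟨K, hK⟩ := h
    rw [hK, map_mul]
    have : aeval v (X i - C a : MvPolynomial (Fin 2) ℂ) = 0 := by
      simp [v]
    rw [this, zero_mul]
  have hC : ∀ p : Polynomial ℂ, Polynomial.aeval (Polynomial.C a) p = Polynomial.C (p.eval a) := by
    intro p
    have := Polynomial.aeval_algebraMap_apply (Polynomial ℂ) a p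
    simpa using this
  simp only [bez, map_sub, map_mul, ← Polynomial.aeval_algHom_apply, aeval_X] at hv
  fin_cases i
  · simp [v, hC] at hv
    exact not_prop hc hQ hR a (by linear_combination hv)
  · simp [v, hC] at hv
    exact not_prop hc hQ hR a (by linear_combination -hv)

lemma cancel_univ (F : MvPolynomial (Fin 2) ℂ) (i : Fin 2)
    (hF : ∀ a : ℂ, ¬ (X i - C a : MvPolynomial (Fin 2) ℂ) ∣ F) (h : Polynomial ℂ) (h0 : h ≠ 0)
    (G : MvPolynomial (Fin 2) ℂ)
    (hd : F ∣ Polynomial.aeval (X i : MvPolynomial (Fin 2) ℂ) h * G) : F ∣ G := by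
  have hs := (IsAlgClosed.splits h).eq_prod_roots
  rw [hs] at hd
  have hl : h.leadingCoeff ≠ 0 := Polynomial.leadingCoeff_ne_zero.mpr h0
  generalize h.roots = s at hd
  generalize h.leadingCoeff = c at hd hl
  induction s using Multiset.induction_on with
  | empty =>
    simp only [Multiset.map_zero, Multiset.prod_zero, mul_one, Polynomial.aeval_C] at hd
    have hu : IsUnit (algebraMap ℂ (MvPolynomial (Fin 2) ℂ) c) := (IsUnit.mk0 c hl).map _
    exact (hu.dvd_mul_left).mp hd
  | cons a s ih =>
    apply ih
    have e : ∀ T : Polynomial ℂ, Polynomial.aeval (X i : MvPolynomial (Fin 2) ℂ)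
        (Polynomial.C c * ((Polynomial.X - Polynomial.C a) * T)) =
        (X i - C a) * Polynomial.aeval (X i : MvPolynomial (Fin 2) ℂ) (Polynomial.C c * T) := by
      intro T
      simp only [map_mul, map_sub, Polynomial.aeval_X, Polynomial.aeval_C, algebraMap_eq]
      ring
    rw [Multiset.map_cons, Multiset.prod_cons, e, mul_assoc] at hd
    obtain ⟨K, hK⟩ := hd
    have hp := prime_X_sub_C i a
    have : (X i - C a) ∣ F * K := ⟨_, hK.symm⟩
    obtain ⟨K', rfl⟩ := (hp.dvd_or_dvd this).resolve_left (hF a)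
    refine ⟨K', mul_left_cancel₀ hp.ne_zero ?_⟩
    rw [hK]; ring

lemma mem_fld_iff {F : MvPolynomial (Fin 2) ℂ}
    (hF : ∀ (i : Fin 2) (a : ℂ), ¬ (X i - C a : MvPolynomial (Fin 2) ℂ) ∣ F)
    {P Q : Polynomial ℂ} (hc : IsCoprime P Q) (hQ : Q ≠ 0) :
    algebraMap (Polynomial ℂ) (RatFunc ℂ) P / algebraMap (Polynomial ℂ) (RatFunc ℂ) Q ∈ fld F
      ↔ F ∣ bez P Q := by
  constructor
  · rintro ⟨p, q, hq, he, hd⟩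
    rw [div_eq_div_iff (RatFunc.algebraMap_ne_zero hQ) (RatFunc.algebraMap_ne_zero hq),
      ← map_mul, ← map_mul] at he
    replace he := RatFunc.algebraMap_injective ℂ he
    obtain ⟨h, rfl⟩ : Q ∣ q := hc.symm.dvd_of_dvd_mul_left ⟨p, by rw [he]; ring⟩
    have hp : p = P * h := by
      apply mul_right_cancel₀ hQ
      rw [← he]; ring
    subst hp
    have h0 : h ≠ 0 := right_ne_zero_of_mul hq
    have : bez (P * h) (Q * h) = Polynomial.aeval (X 0 : MvPolynomial (Fin 2) ℂ) h *
        (Polynomial.aeval (X 1 : MvPolynomial (Fin 2) ℂ) h * bez P Q) := by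
      simp only [bez, map_mul]; ring
    rw [this] at hd
    exact cancel_univ F 1 (hF 1) h h0 _ (cancel_univ F 0 (hF 0) h h0 _ hd)
  · exact fun h => ⟨P, Q, hQ, rfl, h⟩

open IntermediateField in
lemma exists_gen (E : IntermediateField ℂ (RatFunc ℂ)) (hb : E ≠ ⊥) (ht : E ≠ ⊤) :
    ∃ P Q : Polynomial ℂ, IsCoprime P Q ∧ Q ≠ 0 ∧ Q.natDegree < P.natDegree ∧
      2 ≤ P.natDegree ∧ E = IntermediateField.adjoin ℂ
              {algebraMap (Polynomial ℂ) (RatFunc ℂ) P / algebraMap (Polynomial ℂ) (RatFunc ℂ) Q} := by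
  obtain ⟨g, hg⟩ : ∃ g : RatFunc ℂ, E = ℂ⟮g⟯ := ⟨_, RatFunc.Luroth.eq_adjoin_generator⟩
  have hfr := g.finrank_eq_max_natDegree
  have hnc : ¬ ∃ c, g = RatFunc.C c := by
    rintro ⟨c, rfl⟩
    apply hb
    rw [hg, adjoin_simple_eq_bot_iff]
    exact ⟨c, rfl⟩
  have h1 : max g.num.natDegree g.denom.natDegree ≠ 1 := by
    intro h
    rw [h] at hfr
    apply ht
    rw [hg]
    exact IntermediateField.finrank_eq_one_iff_eq_top.mp hfr
  have h0 : ¬ (g.num.natDegree = 0 ∧ g.denom.natDegree = 0) := fun h => hnc (g.eq_C_iff.mpr h)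
  by_cases hlt : g.denom.natDegree < g.num.natDegree
  · refine ⟨g.num, g.denom, g.isCoprime_num_denom, g.denom_ne_zero, hlt, by omega, ?_⟩
    rw [RatFunc.num_div_denom, hg]
  · set p := g.num
    set q := g.denom
    have hq : q ≠ 0 := g.denom_ne_zero
    set c : ℂ := p.coeff q.natDegree / q.leadingCoeff
    have hl : q.leadingCoeff ≠ 0 := Polynomial.leadingCoeff_ne_zero.mpr hq
    have hgpq : algebraMap (Polynomial ℂ) (RatFunc ℂ) p / algebraMap (Polynomial ℂ) (RatFunc ℂ) q = g :=
      RatFunc.num_div_denom g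
    have hqa : algebraMap (Polynomial ℂ) (RatFunc ℂ) q ≠ 0 := RatFunc.algebraMap_ne_zero hq
    set Q : Polynomial ℂ := p - Polynomial.C c * q with hQd
    have hQ0 : Q ≠ 0 := by
      intro h
      apply hnc
      refine ⟨c, ?_⟩
      rw [← hgpq, sub_eq_zero.mp h, map_mul, mul_div_cancel_right₀ _ hqa]
      simp
    have hlt2 : Q.natDegree < q.natDegree := by
      have hle : Q.natDegree ≤ q.natDegree := by
        refine (Polynomial.natDegree_sub_le _ _).trans (max_le (by omega) ?_)
        exact Polynomial.natDegree_C_mul_le _ _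
      refine lt_of_le_of_ne hle fun h => ?_
      have h2 : Q.coeff q.natDegree = 0 := by
        simp only [hQd, Polynomial.coeff_sub, Polynomial.coeff_C_mul, Polynomial.coeff_natDegree, c]
        field_simp
        simp
      rw [← h, Polynomial.coeff_natDegree] at h2
      exact hQ0 (Polynomial.leadingCoeff_eq_zero.mp h2)
    have hr : algebraMap (Polynomial ℂ) (RatFunc ℂ) q / algebraMap (Polynomial ℂ) (RatFunc ℂ) Q
        = (g - algebraMap ℂ (RatFunc ℂ) c)⁻¹ := by
      rw [← inv_div, inv_inj, ← hgpq, hQd, map_sub, map_mul, sub_div, mul_div_cancel_right₀ _ hqa]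
      simp
    refine ⟨q, Q, ?_, hQ0, hlt2, by omega, ?_⟩
    · have : IsCoprime q p := g.isCoprime_num_denom.symm
      have h3 := this.add_mul_left_right (-Polynomial.C c)
      have h5 : Q = p + q * -Polynomial.C c := by rw [hQd]; ring
      rw [h5]; exact h3
    · rw [hr, hg]
      apply le_antisymm
      · rw [adjoin_simple_le_iff]
        have hm := mem_adjoin_simple_self ℂ ((g - algebraMap ℂ (RatFunc ℂ) c)⁻¹)
        have h4 := add_mem (inv_mem hm) (IntermediateField.algebraMap_mem ℂ⟮(g - algebraMap ℂ (RatFunc ℂ) c)⁻¹⟯ c)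
        simpa using h4
      · rw [adjoin_simple_le_iff]
        exact inv_mem (sub_mem (mem_adjoin_simple_self ℂ g) (IntermediateField.algebraMap_mem _ c))

end BezAux


open MvPolynomial in
theorem luroth_field_of_bezoutian_divisor
    (P₁ Q₁ : Polynomial ℂ) (hc1 : IsCoprime P₁ Q₁) (hQ1 : Q₁ ≠ 0)
    (hR1 : 1 ≤ max P₁.natDegree Q₁.natDegree)
    (D B₁star : MvPolynomial (Fin 2) ℂ) (hD : 0 < D.totalDegree)
    (hB1 : (X 0 - X 1) * B₁star
      = Polynomial.aeval (X 0 : MvPolynomial (Fin 2) ℂ) Q₁ * Polynomial.aeval (X 1 : MvPolynomial (Fin 2) ℂ) P₁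
        - Polynomial.aeval (X 0 : MvPolynomial (Fin 2) ℂ) P₁ * Polynomial.aeval (X 1 : MvPolynomial (Fin 2) ℂ) Q₁)
    (hdvd : D ∣ B₁star) :
    ∃ P Q : Polynomial ℂ, IsCoprime P Q ∧ Q ≠ 0 ∧ Q.natDegree < P.natDegree ∧
      2 ≤ P.natDegree ∧
      ∀ P₂ Q₂ : Polynomial ℂ, IsCoprime P₂ Q₂ → Q₂ ≠ 0 →
        ((∃ B₂star : MvPolynomial (Fin 2) ℂ,
            (X 0 - X 1) * B₂star
              = Polynomial.aeval (X 0 : MvPolynomial (Fin 2) ℂ) Q₂ * Polynomial.aeval (X 1 : MvPolynomial (Fin 2) ℂ) P₂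
                - Polynomial.aeval (X 0 : MvPolynomial (Fin 2) ℂ) P₂ * Polynomial.aeval (X 1 : MvPolynomial (Fin 2) ℂ) Q₂
            ∧ D ∣ B₂star) ↔
          algebraMap (Polynomial ℂ) (RatFunc ℂ) P₂ / algebraMap (Polynomial ℂ) (RatFunc ℂ) Q₂ ∈
            IntermediateField.adjoin ℂ
              {algebraMap (Polynomial ℂ) (RatFunc ℂ) P / algebraMap (Polynomial ℂ) (RatFunc ℂ) Q}) := by
  have hxy : (X 0 - X 1 : MvPolynomial (Fin 2) ℂ) ≠ 0 := by
    intro h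
    have := congrArg (MvPolynomial.eval ![(1 : ℂ), 0]) h
    simp at this
  have hFB : (X 0 - X 1) * D ∣ BezAux.bez P₁ Q₁ := by
    rw [BezAux.bez, ← hB1]
    exact mul_dvd_mul_left _ hdvd
  have hF : ∀ (i : Fin 2) (a : ℂ), ¬ (X i - C a : MvPolynomial (Fin 2) ℂ) ∣ (X 0 - X 1) * D :=
    fun i a h => BezAux.not_dvd_bez hc1 hQ1 hR1 i a (h.trans hFB)
  have hb : BezAux.fld ((X 0 - X 1) * D) ≠ ⊥ := by
    intro h
    have hm := (BezAux.mem_fld_iff hF hc1 hQ1).mpr hFB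
    rw [h, IntermediateField.mem_bot] at hm
    obtain ⟨c, hm⟩ := hm
    rw [eq_div_iff (RatFunc.algebraMap_ne_zero hQ1)] at hm
    have h2 : Polynomial.C c * Q₁ = P₁ := by
      apply RatFunc.algebraMap_injective ℂ
      rw [← hm, map_mul]
      simp
    have hu : IsUnit Q₁ := hc1.isUnit_of_dvd' ⟨Polynomial.C c, by rw [← h2]; ring⟩ dvd_rfl
    have h3 := Polynomial.natDegree_eq_zero_of_isUnit hu
    have h4 := Polynomial.natDegree_C_mul_le c Q₁
    rw [h2] at h4
    omega
  have ht : BezAux.fld ((X 0 - X 1) * D) ≠ ⊤ := by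
    intro h
    have hm : algebraMap (Polynomial ℂ) (RatFunc ℂ) Polynomial.X /
        algebraMap (Polynomial ℂ) (RatFunc ℂ) 1 ∈ BezAux.fld ((X 0 - X 1) * D) := by
      rw [h]; trivial
    rw [BezAux.mem_fld_iff hF isCoprime_one_right one_ne_zero] at hm
    obtain ⟨K, hK⟩ := hm
    have hu : D * (-K) = 1 := by
      apply mul_left_cancel₀ hxy
      simp only [BezAux.bez, Polynomial.aeval_X, map_one, one_mul, mul_one] at hK
      linear_combination hK
    have hu' : IsUnit D := IsUnit.of_mul_eq_one _ hu
    rw [MvPolynomial.isUnit_iff_totalDegree_of_isReduced] at hu'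
    omega
  obtain ⟨P, Q, hc, hQ, hlt, h2, hE⟩ := BezAux.exists_gen _ hb ht
  refine ⟨P, Q, hc, hQ, hlt, h2, fun P₂ Q₂ hc2 hQ2 => ?_⟩
  rw [← hE, BezAux.mem_fld_iff hF hc2 hQ2]
  constructor
  · rintro ⟨B, hB, hd⟩
    rw [BezAux.bez, ← hB]
    exact mul_dvd_mul_left _ hd
  · rintro ⟨K, hK⟩
    exact ⟨D * K, by rw [← mul_assoc, ← hK, BezAux.bez], dvd_mul_right _ _⟩
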